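/- arXiv:1506.03037 — 2 statements merged into one kernel-verified Lean document; each statement's English description precedes it below -/
import Mathlib

section
/- For all linear operators X, Y on H and all k ≥ 0, the inner product ⟨X,Y⟩_E satisfies the bi-invariance identities ⟨X,Y⟩_E = ∑_{α∈S^k} ⟨A(α)X, A(α)Y⟩_E = ∑_{α∈S^k} ⟨X A(α), Y A(α)⟩_E. -/
open MeasureTheory Matrix
open scoped ComplexOrder

/-- The compound restriction map `A(α) = A_{α₁} ⋯ A_{α_n}` of a word `α ∈ S^n`. -/
noncomputable def wordMap {S : Type*} {d : Type*} [Fintype d] [DecidableEq d]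
    (A : S → Matrix d d ℂ) {n : ℕ} (α : Fin n → S) : Matrix d d ℂ :=
  (List.ofFn fun i => A (α i)).prod

/-- The inner product `⟨A,B⟩_E = Tr(B* E A)` on the space of operators. -/
noncomputable def innerE {d : Type*} [Fintype d] [DecidableEq d]
    (E X Y : Matrix d d ℂ) : ℂ :=
  (Yᴴ * E * X).trace

theorem wordMap_cons {S : Type*} {d : Type*} [Fintype d] [DecidableEq d]
    (A : S → Matrix d d ℂ) {n : ℕ} (s : S) (α : Fin n → S) :
    wordMap A (Fin.cons s α : Fin (n + 1) → S) = A s * wordMap A α := by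
  simp [wordMap, List.ofFn_succ]

theorem sum_word_succ {S M : Type*} [Fintype S] [AddCommMonoid M] {n : ℕ}
    (f : (Fin (n + 1) → S) → M) :
    ∑ α, f α = ∑ s : S, ∑ α : Fin n → S, f (Fin.cons s α) := by
  rw [← Fintype.sum_prod_type']
  exact ((Fin.consEquiv fun _ => S).sum_comp f).symm

/-- A fixed point of `M ↦ ∑ s, A_s* M A_s` is fixed by the corresponding map for words. -/
theorem sum_conjTranspose_wordMap_mul {S : Type*} [Fintype S]
    {d : Type*} [Fintype d] [DecidableEq d] {A : S → Matrix d d ℂ} {E : Matrix d d ℂ}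
    (h : ∑ s : S, (A s)ᴴ * E * A s = E) (k : ℕ) :
    ∑ α : Fin k → S, (wordMap A α)ᴴ * E * wordMap A α = E := by
  induction k with
  | zero => simp [wordMap]
  | succ k ih =>
    rw [sum_word_succ, Finset.sum_comm]
    refine (Finset.sum_congr rfl fun α _ => ?_).trans ih
    calc ∑ s, (wordMap A (Fin.cons s α : Fin (k + 1) → S))ᴴ * E * wordMap A (Fin.cons s α)
        = (wordMap A α)ᴴ * (∑ s, (A s)ᴴ * E * A s) * wordMap A α := by
          simp only [wordMap_cons, conjTranspose_mul, Finset.mul_sum, Finset.sum_mul,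
            Matrix.mul_assoc]
      _ = (wordMap A α)ᴴ * E * wordMap A α := by rw [h]

/-- If the `A_s A_s*` sum to the identity, then so do the `A(α) A(α)*`. -/
theorem sum_wordMap_mul_conjTranspose {S : Type*} [Fintype S]
    {d : Type*} [Fintype d] [DecidableEq d] {A : S → Matrix d d ℂ}
    (h : ∑ s : S, A s * (A s)ᴴ = 1) (k : ℕ) :
    ∑ α : Fin k → S, wordMap A α * (wordMap A α)ᴴ = 1 := by
  induction k with
  | zero => simp [wordMap]
  | succ k ih =>
    rw [sum_word_succ]
    refine (Finset.sum_congr rfl fun s _ => ?_).trans h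
    calc ∑ α : Fin k → S, wordMap A (Fin.cons s α : Fin (k + 1) → S) *
          (wordMap A (Fin.cons s α : Fin (k + 1) → S))ᴴ
        = A s * (∑ α : Fin k → S, wordMap A α * (wordMap A α)ᴴ) * (A s)ᴴ := by
          simp only [wordMap_cons, conjTranspose_mul, Finset.mul_sum, Finset.sum_mul,
            Matrix.mul_assoc]
      _ = A s * (A s)ᴴ := by rw [ih, Matrix.mul_one]

/-- bi-invariance of the inner product `⟨·,·⟩_E`:
`⟨X,Y⟩_E = ∑_{α∈S^k} ⟨A(α)X, A(α)Y⟩_E = ∑_{α∈S^k} ⟨X A(α), Y A(α)⟩_E`. -/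
theorem innerE_biinvariant
    {S : Type*} [Fintype S] [Nonempty S]
    {d : Type*} [Fintype d] [DecidableEq d]
    (A : S → Matrix d d ℂ) (E : Matrix d d ℂ)
    (hE : E.PosDef) (hTrE : E.trace = 1)
    (hfund1 : ∑ s : S, (A s)ᴴ * E * A s = E)
    (hfund2 : ∑ s : S, A s * (A s)ᴴ = 1) :
    ∀ (X Y : Matrix d d ℂ) (k : ℕ),
      (innerE E X Y =
        ∑ α : Fin k → S, innerE E (wordMap A α * X) (wordMap A α * Y)) ∧
      (innerE E X Y =
        ∑ α : Fin k → S, innerE E (X * wordMap A α) (Y * wordMap A α)) := by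
  intro X Y k
  constructor
  · calc innerE E X Y
        = (Yᴴ * (∑ α : Fin k → S, (wordMap A α)ᴴ * E * wordMap A α) * X).trace := by
          rw [sum_conjTranspose_wordMap_mul hfund1, innerE]
      _ = _ := by
          simp only [innerE, conjTranspose_mul, Finset.mul_sum, Finset.sum_mul, trace_sum,
            Matrix.mul_assoc]
  · calc innerE E X Y
        = (Yᴴ * E * X * ∑ α : Fin k → S, wordMap A α * (wordMap A α)ᴴ).trace := by
          rw [sum_wordMap_mul_conjTranspose hfund2, Matrix.mul_one, innerE]
      _ = _ := by
          rw [Finset.mul_sum, trace_sum]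
          refine Finset.sum_congr rfl fun α _ => ?_
          rw [innerE, conjTranspose_mul, ← Matrix.mul_assoc, trace_mul_comm]
          simp only [Matrix.mul_assoc]
end

section
/- For the Sierpiński gasket matrices, the operator M(B) = ∑_{s=0}^{2} A_s B A_s satisfies M(B) = (4/5)·B for every symmetric traceless real 2×2 matrix B (i.e., every B of the form [[a, b],[b, −a]]), and M(cI) = cI for every scalar c; hence M contracts the space of traceless symmetric matrices with factor θ₁ = 4/5. -/
open Matrix

/-- Rotation of the plane by the angle `2π/3`. -/
noncomputable def sgRot : Matrix (Fin 2) (Fin 2) ℝ :=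
  !![Real.cos (2 * Real.pi / 3), -Real.sin (2 * Real.pi / 3);
     Real.sin (2 * Real.pi / 3),  Real.cos (2 * Real.pi / 3)]

/-- The diagonal matrix `D = diag(3/√15, 1/√15)`. -/
noncomputable def sgD : Matrix (Fin 2) (Fin 2) ℝ :=
  !![3 / Real.sqrt 15, 0; 0, 1 / Real.sqrt 15]

/-- The Sierpiński gasket restriction maps `A_s = R^{-s} D R^{s}`, `s ∈ {0,1,2}`. -/
noncomputable def sgA (s : Fin 3) : Matrix (Fin 2) (Fin 2) ℝ :=
  (sgRot ^ (s : ℕ))⁻¹ * sgD * sgRot ^ (s : ℕ)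

/-- The operator `M(B) = ∑_{s=0}^{2} A_s B A_s` for the Sierpiński gasket system. -/
noncomputable def sgM (B : Matrix (Fin 2) (Fin 2) ℝ) : Matrix (Fin 2) (Fin 2) ℝ :=
  ∑ s : Fin 3, sgA s * B * sgA s

theorem sgRot_eq : sgRot = !![-1 / 2, -(√3 / 2); √3 / 2, -1 / 2] := by
  have h : 2 * Real.pi / 3 = Real.pi - Real.pi / 3 := by ring
  rw [sgRot, h, Real.cos_pi_sub, Real.sin_pi_sub, Real.cos_pi_div_three, Real.sin_pi_div_three,
    neg_div]

theorem sgRot_sq : sgRot ^ 2 = !![-1 / 2, √3 / 2; -(√3 / 2), -1 / 2] := by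
  have h : √3 ^ 2 = (3 : ℝ) := Real.sq_sqrt (by norm_num)
  rw [sgRot_eq, pow_two, mul_fin_two]
  congr! 3 <;> grind

theorem sgRot_inv : sgRot⁻¹ = !![-1 / 2, √3 / 2; -(√3 / 2), -1 / 2] := by
  have h : √3 ^ 2 = (3 : ℝ) := Real.sq_sqrt (by norm_num)
  apply inv_eq_right_inv
  rw [sgRot_eq, mul_fin_two, one_fin_two]
  congr! 3 <;> grind

theorem sgRot_sq_inv : (sgRot ^ 2)⁻¹ = sgRot := by
  have h : √3 ^ 2 = (3 : ℝ) := Real.sq_sqrt (by norm_num)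
  apply inv_eq_right_inv
  rw [sgRot_sq, sgRot_eq, mul_fin_two, one_fin_two]
  congr! 3 <;> grind

theorem sgA_zero : sgA 0 = (√15)⁻¹ • !![3, 0; 0, 1] := by
  simp [sgA, sgD, div_eq_inv_mul]

theorem sgA_one : sgA 1 = (√15)⁻¹ • !![3 / 2, √3 / 2; √3 / 2, 5 / 2] := by
  have h : √3 ^ 2 = (3 : ℝ) := Real.sq_sqrt (by norm_num)
  rw [sgA, Fin.val_one, pow_one, sgRot_inv, sgRot_eq, sgD]
  ext i j
  fin_cases i <;> fin_cases j <;> simp <;> grind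

theorem sgA_two : sgA 2 = (√15)⁻¹ • !![3 / 2, -(√3 / 2); -(√3 / 2), 5 / 2] := by
  have h : √3 ^ 2 = (3 : ℝ) := Real.sq_sqrt (by norm_num)
  rw [sgA, Fin.val_two, sgRot_sq_inv, sgRot_sq, sgRot_eq, sgD]
  ext i j
  fin_cases i <;> fin_cases j <;> simp <;> grind

theorem sgM_of (a b c d : ℝ) : sgM !![a, b; c, d] =
    !![(9 * a + d) / 10, (7 * b + c) / 10; (b + 7 * c) / 10, (a + 9 * d) / 10] := by
  have h : √3 ^ 2 = (3 : ℝ) := Real.sq_sqrt (by norm_num)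
  have h15 : (√15)⁻¹ ^ 2 = (15 : ℝ)⁻¹ := by rw [inv_pow, Real.sq_sqrt (by norm_num)]
  rw [sgM, Fin.sum_univ_three, sgA_zero, sgA_one, sgA_two]
  ext i j
  fin_cases i <;> fin_cases j <;> simp <;> grind

/-- `M(B) = (4/5)·B` for every symmetric traceless `B = [[a,b],[b,-a]]`,
and `M(cI) = cI`; hence `M` contracts traceless symmetric matrices by `θ₁ = 4/5`. -/
theorem sgM_action :
    (∀ a b : ℝ, sgM !![a, b; b, -a] = (4 / 5 : ℝ) • !![a, b; b, -a]) ∧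
    (∀ c : ℝ, sgM (c • (1 : Matrix (Fin 2) (Fin 2) ℝ)) =
      c • (1 : Matrix (Fin 2) (Fin 2) ℝ)) := by
  refine ⟨fun a b => ?_, fun c => ?_⟩
  · rw [sgM_of]
    ext i j
    fin_cases i <;> fin_cases j <;> simp <;> ring
  · have h : c • (1 : Matrix (Fin 2) (Fin 2) ℝ) = !![c, 0; 0, c] := by
      simp [one_fin_two]
    rw [h, sgM_of]
    ext i j
    fin_cases i <;> fin_cases j <;> simp <;> ring
end
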